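/- Let A = (a_{ij}) be an n-th Bott matrix and for 1 ≤ i ≤ n let g_i : Tⁿ → Tⁿ be the map defined by the Bott matrix action. Then each g_i is a homeomorphism with g_i² = id, the maps g₁,…,g_n pairwise commute, so they generate an action of (ℤ/2ℤ)ⁿ on Tⁿ, and this action is free: for every nonzero (ε₁,…,ε_n) ∈ (ℤ/2ℤ)ⁿ the composite g₁^{ε₁} ∘ ⋯ ∘ g_n^{ε_n} has no fixed point in Tⁿ. -/

import Mathlib

/-- The generator `gᵢ` of the Bott matrix action of `(ℤ/2ℤ)ⁿ` on the torus
`Tⁿ = (ℝ/ℤ)ⁿ`, for an `n`-th Bott matrix `A`: it fixes the coordinates `j < i`,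
adds `1/2` to the `i`-th coordinate and multiplies the coordinates `j > i` by
`(-1) ^ (A i j)`. -/
noncomputable def bottGen {n : ℕ} (A : Fin n → Fin n → ℕ) (i : Fin n) :
    (Fin n → AddCircle (1 : ℝ)) → (Fin n → AddCircle (1 : ℝ)) :=
  fun x j =>
    if j < i then x j
    else if j = i then x j + (↑(1 / 2 : ℝ) : AddCircle (1 : ℝ))
    else ((-1 : ℤ) ^ A i j) • x j

theorem List.apply_foldr_comp_ofFn {X M : Type*} [AddCommMonoid M] (φ : X → M) {k : ℕ}
    (f : Fin k → X → X) (c : Fin k → M) (h : ∀ i y, φ (f i y) = φ y + c i) (x : X) :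
    φ ((List.ofFn f).foldr (· ∘ ·) id x) = φ x + ∑ i, c i := by
  induction k with
  | zero => simp
  | succ k ih =>
    rw [List.ofFn_succ, List.foldr_cons, Function.comp_apply, h,
      ih (fun i => f i.succ) (fun i => c i.succ) (fun i => h i.succ), Fin.sum_univ_succ,
      add_assoc, add_comm (∑ i : Fin k, c i.succ)]

theorem AddCircle.half_add_half :
    (↑(1 / 2 : ℝ) : AddCircle (1 : ℝ)) + (↑(1 / 2 : ℝ) : AddCircle (1 : ℝ)) = 0 := by
  rw [← AddCircle.coe_add, add_halves, AddCircle.coe_period]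

theorem AddCircle.half_ne_zero : (↑(1 / 2 : ℝ) : AddCircle (1 : ℝ)) ≠ 0 := by
  intro h
  obtain ⟨k, hk⟩ := AddCircle.coe_eq_zero_iff (1 : ℝ) |>.1 h
  rw [zsmul_eq_mul, mul_one] at hk
  have h2 : ((2 * k : ℤ) : ℝ) = (1 : ℤ) := by push_cast; linarith
  have := Int.cast_injective h2
  omega

theorem AddCircle.neg_one_pow_zsmul_half (a : ℕ) :
    ((-1 : ℤ) ^ a) • (↑(1 / 2 : ℝ) : AddCircle (1 : ℝ)) = ↑(1 / 2 : ℝ) := by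
  rcases neg_one_pow_eq_or ℤ a with h | h
  · rw [h, one_zsmul]
  · rw [h, neg_one_zsmul, neg_eq_iff_add_eq_zero, AddCircle.half_add_half]

section bottGen

variable {n : ℕ} (A : Fin n → Fin n → ℕ)

theorem bottGen_apply_of_lt {i j : Fin n} (h : j < i) (x : Fin n → AddCircle (1 : ℝ)) :
    bottGen A i x j = x j :=
  if_pos h

theorem bottGen_apply_self (i : Fin n) (x : Fin n → AddCircle (1 : ℝ)) :
    bottGen A i x i = x i + (↑(1 / 2 : ℝ) : AddCircle (1 : ℝ)) := by
  simp [bottGen]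

theorem bottGen_apply_of_gt {i j : Fin n} (h : i < j) (x : Fin n → AddCircle (1 : ℝ)) :
    bottGen A i x j = ((-1 : ℤ) ^ A i j) • x j := by
  simp [bottGen, h.not_gt, h.ne']

theorem continuous_bottGen (i : Fin n) : Continuous (bottGen A i) := by
  refine continuous_pi fun j => ?_
  rcases lt_trichotomy j i with h | rfl | h
  · simpa only [bottGen_apply_of_lt A h] using continuous_apply j
  · simpa only [bottGen_apply_self] using (continuous_apply j).add_const _
  · simp only [bottGen_apply_of_gt A h]
    exact (continuous_apply j).zsmul _

theorem bottGen_involutive (i : Fin n) : Function.Involutive (bottGen A i) := by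
  intro x
  funext j
  rcases lt_trichotomy j i with h | rfl | h
  · simp only [bottGen_apply_of_lt A h]
  · simp only [bottGen_apply_self, add_assoc, AddCircle.half_add_half, add_zero]
  · simp only [bottGen_apply_of_gt A h, smul_smul, ← mul_pow, neg_mul_neg, one_mul, one_pow,
      one_smul]

theorem bottGen_commute_of_lt {i j : Fin n} (hij : i < j) (x : Fin n → AddCircle (1 : ℝ)) :
    bottGen A i (bottGen A j x) = bottGen A j (bottGen A i x) := by
  funext k
  rcases lt_trichotomy k j with h | rfl | h
  · rw [bottGen_apply_of_lt A h]
    rcases lt_trichotomy k i with h' | rfl | h'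
    · simp only [bottGen_apply_of_lt A h', bottGen_apply_of_lt A h]
    · simp only [bottGen_apply_self, bottGen_apply_of_lt A h]
    · simp only [bottGen_apply_of_gt A h', bottGen_apply_of_lt A h]
  · simp only [bottGen_apply_of_gt A hij, bottGen_apply_self, smul_add,
      AddCircle.neg_one_pow_zsmul_half]
  · simp only [bottGen_apply_of_gt A (hij.trans h), bottGen_apply_of_gt A h]
    rw [smul_comm]

theorem bottGen_commute (i j : Fin n) :
    Function.Commute (bottGen A i) (bottGen A j) := by
  rcases lt_trichotomy i j with h | rfl | h
  · exact bottGen_commute_of_lt A h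
  · exact Function.Commute.refl _
  · exact Function.Semiconj.commute (fun x => (bottGen_commute_of_lt A h x).symm)

theorem bottGen_iterate_apply_of_lt {i j : Fin n} (h : j < i) (k : ℕ)
    (x : Fin n → AddCircle (1 : ℝ)) : (bottGen A i)^[k] x j = x j := by
  induction k generalizing x with
  | zero => rfl
  | succ k ih => rw [Function.iterate_succ_apply, ih, bottGen_apply_of_lt A h]

/-- The first coordinate at which `ε` does not vanish is translated by `1/2`. -/
theorem foldr_bottGen_apply {ε : Fin n → ZMod 2} {m : Fin n} (hm : ε m ≠ 0)
    (hlt : ∀ i < m, ε i = 0) (x : Fin n → AddCircle (1 : ℝ)) :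
    (List.ofFn fun i => (bottGen A i)^[(ε i).val]).foldr (· ∘ ·) id x m =
      x m + (↑(1 / 2 : ℝ) : AddCircle (1 : ℝ)) := by
  rw [List.apply_foldr_comp_ofFn (fun y => y m) _
    (Pi.single m (↑(1 / 2 : ℝ) : AddCircle (1 : ℝ))) ?_ x, Fintype.sum_pi_single']
  intro i y
  rcases lt_trichotomy i m with h | rfl | h
  · simp [hlt i h, h.ne]
  · have hval : (ε i).val = 1 := by
      have := (ZMod.val_ne_zero _).2 hm
      have := ZMod.val_lt (ε i)
      omega
    rw [hval, Function.iterate_one, bottGen_apply_self, Pi.single_eq_same]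
  · rw [bottGen_iterate_apply_of_lt A h, Pi.single_eq_of_ne h.ne', add_zero]

end bottGen

/-- For an `n`-th Bott matrix `A` (upper triangular, entries in `{0,1}`, diagonal `1`),
the maps `g₁, …, gₙ` of the Bott matrix action on `Tⁿ = (ℝ/ℤ)ⁿ` are homeomorphisms
with `gᵢ² = id`, they pairwise commute — hence generate an action of `(ℤ/2ℤ)ⁿ` on
`Tⁿ` — and this action is free: for every nonzero `ε ∈ (ℤ/2ℤ)ⁿ` the composite
`g₁^ε₁ ∘ ⋯ ∘ gₙ^εₙ` has no fixed point. -/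
theorem bott_action_free
    {n : ℕ} (A : Fin n → Fin n → ℕ)
    (hval : ∀ i j, A i j = 0 ∨ A i j = 1)
    (hdiag : ∀ i, A i i = 1)
    (hlow : ∀ i j : Fin n, j < i → A i j = 0) :
    (∀ i, ∃ h : (Fin n → AddCircle (1 : ℝ)) ≃ₜ (Fin n → AddCircle (1 : ℝ)),
        ⇑h = bottGen A i) ∧
    (∀ i, bottGen A i ∘ bottGen A i = id) ∧
    (∀ i j, bottGen A i ∘ bottGen A j = bottGen A j ∘ bottGen A i) ∧
    (∀ ε : Fin n → ZMod 2, ε ≠ 0 → ∀ x : Fin n → AddCircle (1 : ℝ),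
        (List.ofFn fun i => (bottGen A i)^[(ε i).val]).foldr (· ∘ ·) id x ≠ x) := by
  refine ⟨fun i => ⟨⟨(bottGen_involutive A i).toPerm, continuous_bottGen A i,
    continuous_bottGen A i⟩, rfl⟩, fun i => (bottGen_involutive A i).comp_self,
    fun i j => (bottGen_commute A i j).comp_eq, fun ε hε x hx => ?_⟩
  obtain ⟨m, hm, hmin⟩ := WellFounded.has_min (wellFounded_lt (α := Fin n)) {i | ε i ≠ 0}
    (Function.ne_iff.1 hε)
  have h := foldr_bottGen_apply A hm (fun i hi => not_not.1 fun h => hmin i h hi) x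
  rw [hx, left_eq_add] at h
  exact AddCircle.half_ne_zero h
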